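/- arXiv:2105.04868 — 3 statements merged into one kernel-verified Lean document; each statement's English description precedes it below -/
import Mathlib

section
/- For every nonzero vector v : Fin 3 → ℍ, the following are equivalent: (a) there exists λ : ℍ such that τ(v i) = λ * (v i) for every i (i.e. the quaternionic line spanned by v is invariant under coordinatewise application of τ); (b) there exists μ : ℍ with μ ≠ 0 such that every coordinate of μ • v is fixed by τ (i.e. that line is spanned by a vector all of whose coordinates lie in the fixed subring of τ). -/
open scoped Quaternion

noncomputable section

/-- The quaternion `j`. -/
def qj : ℍ[ℝ] := ⟨0, 0, 1, 0⟩

/-- Conjugation by `j` on the real quaternions. -/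
def τ (x : ℍ[ℝ]) : ℍ[ℝ] := qj * x * qj⁻¹

theorem qj_ne_zero : qj ≠ 0 := fun h => by
  simpa [qj] using congrArg QuaternionAlgebra.imJ h

theorem τ_mul (x y : ℍ[ℝ]) : τ (x * y) = τ x * τ y := by
  simp only [τ, mul_assoc, inv_mul_cancel_left₀ qj_ne_zero]

theorem τ_inv (x : ℍ[ℝ]) : τ x⁻¹ = (τ x)⁻¹ := by
  simp only [τ, mul_inv_rev, inv_inv, mul_assoc]

theorem τ_ne_zero {x : ℍ[ℝ]} (hx : x ≠ 0) : τ x ≠ 0 :=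
  mul_ne_zero (mul_ne_zero qj_ne_zero hx) (inv_ne_zero qj_ne_zero)

/-- For a nonzero vector `v : ℍ³`, the quaternionic line spanned by `v` is invariant under
coordinatewise application of `τ` (i.e. `τ(v i) = λ * v i` for some `λ` and all `i`) iff
that line is spanned by a vector whose coordinates are all fixed by `τ`. -/
theorem stmt6 (v : Fin 3 → ℍ[ℝ]) (hv : v ≠ 0) :
    (∃ l : ℍ[ℝ], ∀ i, τ (v i) = l * v i) ↔
    (∃ μ : ℍ[ℝ], μ ≠ 0 ∧ ∀ i, τ ((μ • v) i) = (μ • v) i) := by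
  simp only [Pi.smul_apply, smul_eq_mul, τ_mul]
  constructor
  · rintro ⟨l, hl⟩
    obtain ⟨i₀, hi₀⟩ := Function.ne_iff.mp hv
    have hl₀ : l ≠ 0 := left_ne_zero_of_mul (hl i₀ ▸ τ_ne_zero hi₀)
    refine ⟨(v i₀)⁻¹, inv_ne_zero hi₀, fun i => ?_⟩
    rw [τ_inv, hl, hl, mul_inv_rev, mul_assoc, inv_mul_cancel_left₀ hl₀]
  · rintro ⟨μ, hμ, h⟩
    refine ⟨(τ μ)⁻¹ * μ, fun i => ?_⟩
    rw [mul_assoc, ← h i, inv_mul_cancel_left₀ (τ_ne_zero hμ)]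

end
end

section
/- The map ℙ(ℂ³) → ℙ(ℍ³) induced on projectivizations by the coordinatewise map Φ : (Fin 3 → ℂ) → (Fin 3 → ℍ), Φ(v) i = φ(v i) (which is injective and φ-semilinear), is injective, and its range is exactly the fixed-point set {P : ℙ(ℍ³) | F(P) = P} of the involution F. (This expresses that the fixed-point set of the conjugation action on the quaternionic projective plane is the complex projective plane, (ℍP²)^{C₂} ≅ ℂP².) -/
open scoped Quaternion

noncomputable section

/-- The coordinatewise application of `τ` on `ℍ³`. -/
def T (v : Fin 3 → ℍ[ℝ]) : Fin 3 → ℍ[ℝ] := fun i => τ (v i)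

/-- The ring homomorphism `φ : ℂ → ℍ`, `φ(a + b·i) = a + b·j`. -/
def φ (z : ℂ) : ℍ[ℝ] := ⟨z.re, 0, z.im, 0⟩

/-- The coordinatewise application of `φ` on `ℂ³`. -/
def Φ (v : Fin 3 → ℂ) : Fin 3 → ℍ[ℝ] := fun i => φ (v i)

@[simp] theorem φ_re (z : ℂ) : (φ z).re = z.re := rfl

@[simp] theorem φ_imI (z : ℂ) : (φ z).imI = 0 := rfl

@[simp] theorem φ_imJ (z : ℂ) : (φ z).imJ = z.im := rfl

@[simp] theorem φ_imK (z : ℂ) : (φ z).imK = 0 := rfl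

theorem φ_mul (z w : ℂ) : φ (z * w) = φ z * φ w := by
  ext <;> simp

theorem φ_zero : φ 0 = 0 := by
  ext <;> simp

theorem φ_one : φ 1 = 1 := by
  ext <;> simp

theorem φ_injective : Function.Injective φ := by
  intro z w h
  exact Complex.ext (congrArg QuaternionAlgebra.re h) (congrArg QuaternionAlgebra.imJ h)

theorem φ_I : φ Complex.I = qj := by
  ext <;> simp [φ, qj]

theorem τ_eq_self_iff {x : ℍ[ℝ]} : τ x = x ↔ qj * x = x * qj :=
  mul_inv_eq_iff_eq_mul₀ qj_ne_zero

theorem τ_one : τ 1 = 1 :=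
  τ_eq_self_iff.mpr (by rw [one_mul, mul_one])

theorem τ_φ (z : ℂ) : τ (φ z) = φ z :=
  τ_eq_self_iff.mpr (by rw [← φ_I, ← φ_mul, ← φ_mul, mul_comm])

theorem exists_φ_eq_of_τ_eq {x : ℍ[ℝ]} (h : τ x = x) : ∃ z, φ z = x := by
  rw [τ_eq_self_iff, ← φ_I] at h
  have hI : -x.imI = x.imI := by simpa using congrArg QuaternionAlgebra.imK h
  have hK : x.imK = -x.imK := by simpa using congrArg QuaternionAlgebra.imI h
  refine ⟨⟨x.re, x.imJ⟩, ?_⟩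
  ext <;> simp only [φ_re, φ_imI, φ_imJ, φ_imK] <;> linarith

theorem Φ_injective : Function.Injective Φ := fun _ _ h =>
  funext fun i => φ_injective (congrFun h i)

theorem Φ_smul (c : ℂ) (v : Fin 3 → ℂ) : Φ (c • v) = φ c • Φ v :=
  funext fun i => φ_mul c (v i)

theorem Φ_ne_zero {v : Fin 3 → ℂ} (hv : v ≠ 0) : Φ v ≠ 0 := fun h =>
  hv (Φ_injective (h.trans (funext fun _ => φ_zero.symm)))

theorem T_Φ (v : Fin 3 → ℂ) : T (Φ v) = Φ v :=
  funext fun i => τ_φ (v i)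

theorem exists_Φ_eq_of_T_eq {v : Fin 3 → ℍ[ℝ]} (h : T v = v) : ∃ u, Φ u = v := by
  choose u hu using fun i => exists_φ_eq_of_τ_eq (congrFun h i)
  exact ⟨u, funext hu⟩

/-- Every point of projective space has a representative with a coordinate equal to `1`. -/
theorem Projectivization.exists_mk_eq_coord_eq_one {K ι : Type*} [DivisionRing K]
    (P : Projectivization K (ι → K)) :
    ∃ (v : ι → K) (hv : v ≠ 0) (i : ι), v i = 1 ∧ Projectivization.mk K v hv = P := by
  induction P with
  | h v hv =>
    obtain ⟨i, hi⟩ := Function.ne_iff.mp hv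
    have hi : v i ≠ 0 := hi
    refine ⟨(v i)⁻¹ • v, smul_ne_zero (inv_ne_zero hi) hv, i, inv_mul_cancel₀ hi, ?_⟩
    exact (Projectivization.mk_eq_mk_iff' K _ _ _ _).mpr ⟨(v i)⁻¹, rfl⟩

/-- The map `ℙ(ℂ³) → ℙ(ℍ³)` induced on projectivizations by the (injective and
`φ`-semilinear) coordinatewise map `Φ` is injective, and its range is exactly the
fixed-point set of the involution `F` of `ℙ(ℍ³)` induced by `T`:
`(ℍP²)^{C₂} ≅ ℂP²`. -/
theorem stmt7 :
    Function.Injective Φ ∧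
    (∀ (c : ℂ) (v : Fin 3 → ℂ), Φ (c • v) = φ c • Φ v) ∧
    ∀ F : Projectivization ℍ[ℝ] (Fin 3 → ℍ[ℝ]) → Projectivization ℍ[ℝ] (Fin 3 → ℍ[ℝ]),
      (∀ (v : Fin 3 → ℍ[ℝ]) (hv : v ≠ 0) (hTv : T v ≠ 0),
        F (Projectivization.mk ℍ[ℝ] v hv) = Projectivization.mk ℍ[ℝ] (T v) hTv) →
      ∀ G : Projectivization ℂ (Fin 3 → ℂ) → Projectivization ℍ[ℝ] (Fin 3 → ℍ[ℝ]),
        (∀ (v : Fin 3 → ℂ) (hv : v ≠ 0) (hΦv : Φ v ≠ 0),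
          G (Projectivization.mk ℂ v hv) = Projectivization.mk ℍ[ℝ] (Φ v) hΦv) →
        Function.Injective G ∧
        Set.range G = {P : Projectivization ℍ[ℝ] (Fin 3 → ℍ[ℝ]) | F P = P} := by
  refine ⟨Φ_injective, Φ_smul, fun F hF G hG => ⟨fun P Q h => ?_, Set.Subset.antisymm ?_ ?_⟩⟩
  · induction P with
    | h u hu =>
      obtain ⟨v, hv, i, hi, rfl⟩ := Q.exists_mk_eq_coord_eq_one
      rw [hG u hu (Φ_ne_zero hu), hG v hv (Φ_ne_zero hv),
        Projectivization.mk_eq_mk_iff'] at h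
      obtain ⟨a, ha⟩ := h
      have hai : a = φ (u i) := by
        simpa [Φ, hi, φ_one] using congrFun ha i
      refine (Projectivization.mk_eq_mk_iff' ℂ _ _ _ _).mpr ⟨u i, Φ_injective ?_⟩
      rw [Φ_smul, ← hai, ha]
  · rintro _ ⟨P, rfl⟩
    induction P with
    | h v hv =>
      have hT : T (Φ v) ≠ 0 := by simpa only [T_Φ] using Φ_ne_zero hv
      rw [Set.mem_ofPred_eq, hG v hv (Φ_ne_zero hv), hF _ _ hT]
      simp only [T_Φ]
  · intro P hP
    obtain ⟨v, hv, i, hi, rfl⟩ := P.exists_mk_eq_coord_eq_one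
    have hTi : T v i = 1 := by rw [T, hi, τ_one]
    have hT : T v ≠ 0 := fun h => one_ne_zero (hTi.symm.trans (congrFun h i))
    rw [Set.mem_ofPred_eq, hF v hv hT, Projectivization.mk_eq_mk_iff'] at hP
    obtain ⟨a, ha⟩ := hP
    have ha1 : a = 1 := by simpa [hi, hTi] using congrFun ha i
    rw [ha1, one_smul] at ha
    obtain ⟨u, rfl⟩ := exists_Φ_eq_of_T_eq ha.symm
    have hu : u ≠ 0 := by
      rintro rfl
      exact hv (funext fun _ => φ_zero)
    exact ⟨Projectivization.mk ℂ u hu, hG u hu hv⟩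

end
end

section
/- For n ≥ 1, two invertible matrices A, B ∈ GL(n, ℝ) lie in the same connected component of GL(n, ℝ) if and only if their determinants have the same sign (i.e. 0 < det(A) * det(B)); consequently GL(n, ℝ) has exactly two connected components. -/
open Matrix in
/-- A map into `GL n ℝ` is continuous as soon as its matrix coefficients are. -/
theorem Matrix.GeneralLinearGroup.continuous_of_continuous_val {X ι : Type*} [TopologicalSpace X]
    [Fintype ι] [DecidableEq ι] {f : X → GL ι ℝ}
    (hf : Continuous fun x ↦ (f x : Matrix ι ι ℝ)) : Continuous f := by
  refine Units.continuous_iff.2 ⟨hf, ?_⟩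
  have h : (fun x ↦ ((f x)⁻¹ : GL ι ℝ).val) =
      fun x ↦ (f x).val.det⁻¹ • (f x).val.adjugate := by
    ext1 x
    rw [Matrix.coe_units_inv, Matrix.inv_def, Ring.inverse_eq_inv']
  rw [h]
  exact (hf.matrix_det.inv₀ fun x ↦ (f x).det_ne_zero).smul hf.matrix_adjugate

open Matrix in
/-- A continuous path of matrices with nonvanishing determinant joins its endpoints in
`GL n ℝ`. -/
theorem Matrix.GeneralLinearGroup.joined_of_path {ι : Type*} [Fintype ι] [DecidableEq ι]
    {A B : GL ι ℝ} (f : ℝ → Matrix ι ι ℝ) (hf : Continuous f)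
    (hdet : ∀ t ∈ Set.Icc (0 : ℝ) 1, (f t).det ≠ 0) (h0 : f 0 = A) (h1 : f 1 = B) :
    Joined A B :=
  ⟨{ toFun := fun t ↦ GeneralLinearGroup.mkOfDetNeZero (f t) (hdet t t.2)
     continuous_toFun := GeneralLinearGroup.continuous_of_continuous_val
      (hf.comp continuous_subtype_val)
     source' := Units.ext h0
     target' := Units.ext h1 }⟩

open Matrix in
theorem Matrix.SpecialLinearGroup.joined_one_transvection {ι : Type*} [Fintype ι]
    [DecidableEq ι] {i j : ι} (hij : i ≠ j) (c : ℝ) :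
    Joined (1 : GL ι ℝ) (SpecialLinearGroup.transvection hij c : SpecialLinearGroup ι ℝ) := by
  refine GeneralLinearGroup.joined_of_path (fun t ↦ Matrix.transvection i j (t * c)) ?_ ?_ ?_ ?_
  · have h (t : ℝ) : Matrix.transvection i j (t * c) = 1 + t • Matrix.single i j c := by
      simp [Matrix.transvection, Matrix.smul_single]
    simp_rw [h]
    fun_prop
  · intro t _
    simp [Matrix.det_transvection_of_ne i j hij]
  · simp
  · simp only [one_mul]
    rfl

open Matrix in
/-- The diagonal matrix `diag(c, c⁻¹)` in the coordinates `i, j` is a product of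
transvections. -/
theorem Matrix.SpecialLinearGroup.diag2n_eq_prod_transvection {ι F : Type*} [Fintype ι]
    [DecidableEq ι] [Field F] {i j : ι} (hij : i ≠ j) {c : F} (hc : c ≠ 0) :
    diag2n hij c hc = transvection hij c * transvection hij.symm (-c⁻¹) * transvection hij c *
      (transvection hij (-1) * transvection hij.symm 1 * transvection hij (-1)) := by
  have h (a : F) (ha : a ≠ 0) : (transvection hij a * transvection hij.symm (-a⁻¹) *
      transvection hij a : Matrix ι ι F) = 1 - single i i 1 - single j j 1 +
        single i j a - single j i a⁻¹ := by
    simp only [transvection_coe, mul_add, add_mul, mul_one, one_mul,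
      single_mul_single_same, single_mul_single_of_ne _ _ _ _ hij.symm, ← single_neg, mul_neg, neg_mul,
      mul_inv_cancel₀ ha, inv_mul_cancel₀ ha]
    abel
  have h' := h (-1) (neg_ne_zero.2 one_ne_zero)
  rw [inv_neg, inv_one, neg_neg] at h'
  refine Subtype.ext ?_
  rw [coe_mul, coe_mul, coe_mul, coe_mul, coe_mul, h c hc, h', diag2n_coe]
  have hdiag : diagonal (fun k ↦ if k = i then c else if k = j then c⁻¹ else 1) =
      (1 : Matrix ι ι F) - single i i 1 - single j j 1 + single i i c + single j j c⁻¹ := by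
    ext k l
    simp only [diagonal_apply, one_apply, single_apply, add_apply, sub_apply]
    grind
  rw [hdiag]
  simp only [mul_add, add_mul, mul_sub, sub_mul, mul_one, one_mul,
    single_mul_single_same, single_mul_single_of_ne _ _ _ _ hij,
    single_mul_single_of_ne _ _ _ _ hij.symm, ← single_neg, mul_neg]
  abel

open Matrix in
/-- `SL n ℝ` lies in the path component of the identity of `GL n ℝ`. -/
theorem Matrix.SpecialLinearGroup.joined_one {ι : Type*} [Fintype ι] [DecidableEq ι]
    (A : SpecialLinearGroup ι ℝ) : Joined (1 : GL ι ℝ) A := by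
  have hmul (A B : SpecialLinearGroup ι ℝ) (hA : Joined (1 : GL ι ℝ) A)
      (hB : Joined (1 : GL ι ℝ) B) : Joined (1 : GL ι ℝ) (A * B : SpecialLinearGroup ι ℝ) := by
    simpa using hA.mul hB
  cases subsingleton_or_nontrivial ι
  · rw [Subsingleton.elim A 1, map_one]
  · refine diagonal_transvection_induction' _ A (fun i j hij c hc ↦ ?_)
      (fun i j hij a ↦ joined_one_transvection hij a) hmul
    rw [diag2n_eq_prod_transvection]
    exact hmul _ _ (hmul _ _ (hmul _ _ (joined_one_transvection _ _)
      (joined_one_transvection _ _)) (joined_one_transvection _ _))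
      (hmul _ _ (hmul _ _ (joined_one_transvection _ _) (joined_one_transvection _ _))
        (joined_one_transvection _ _))

open Matrix in
theorem Matrix.det_diagonal_update_one {ι R : Type*} [Fintype ι] [DecidableEq ι] [CommRing R]
    (i : ι) (d : R) : (diagonal (Function.update 1 i d)).det = d := by
  simp [Finset.prod_update_of_mem]

open Matrix in
/-- A real matrix of positive determinant lies in the path component of the identity. -/
theorem Matrix.GeneralLinearGroup.joined_one_of_det_pos {ι : Type*} [Fintype ι] [DecidableEq ι]
    [Nonempty ι] (A : GL ι ℝ) (hA : 0 < (A : Matrix ι ι ℝ).det) : Joined 1 A := by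
  obtain ⟨i⟩ := ‹Nonempty ι›
  set d := (A : Matrix ι ι ℝ).det with hd
  have hD : (diagonal (Function.update 1 i d)).det ≠ 0 := by
    rw [det_diagonal_update_one]; exact hA.ne'
  let D : GL ι ℝ := GeneralLinearGroup.mkOfDetNeZero _ hD
  have hDval : (D : Matrix ι ι ℝ) = diagonal (Function.update 1 i d) := rfl
  have h1D : Joined 1 D := by
    refine joined_of_path (fun t ↦ diagonal (Function.update 1 i (1 + t * (d - 1)))) ?_ ?_ ?_ ?_
    · exact (continuous_const.update i (by fun_prop)).matrix_diagonal
    · rintro t ⟨h0, h1⟩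
      rw [det_diagonal_update_one]
      rcases h0.eq_or_lt with rfl | h0
      · simp
      · nlinarith [mul_pos h0 hA]
    · simp
    · simp [hDval]
  have hdet : ((A * D⁻¹ : GL ι ℝ) : Matrix ι ι ℝ).det = 1 := by
    rw [Units.val_mul, det_mul, Matrix.coe_units_inv, det_nonsing_inv, hDval,
      det_diagonal_update_one, ← hd, Ring.inverse_eq_inv', mul_inv_cancel₀ hA.ne']
  let S : SpecialLinearGroup ι ℝ := ⟨_, hdet⟩
  have h := (SpecialLinearGroup.joined_one S).mul h1D
  have hS : (S : GL ι ℝ) = A * D⁻¹ := Units.ext rfl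
  simpa [hS] using h

open Matrix in
/-- Two invertible real matrices lie in the same connected component iff their determinants
have the same sign. -/
theorem Matrix.GeneralLinearGroup.connectedComponent_eq_iff {ι : Type*} [Fintype ι]
    [DecidableEq ι] [Nonempty ι] (A B : GL ι ℝ) :
    connectedComponent A = connectedComponent B ↔
      0 < (A : Matrix ι ι ℝ).det * (B : Matrix ι ι ℝ).det := by
  constructor
  · intro h
    have hc : Continuous fun M : GL ι ℝ ↦ SignType.sign (M : Matrix ι ι ℝ).det :=
      continuous_iff_continuousAt.2 fun M ↦
        (continuousAt_sign_of_ne_zero M.det_ne_zero).comp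
          (f := fun M : GL ι ℝ ↦ (M : Matrix ι ι ℝ).det)
          (Units.continuous_val.matrix_det.continuousAt)
    have hs := hc.image_eq_of_connectedComponent_eq A B h
    rw [← sign_eq_one_iff, sign_mul, hs, ← sign_mul, sign_eq_one_iff]
    exact mul_self_pos.2 B.det_ne_zero
  · intro h
    have hdet : 0 < ((A⁻¹ * B : GL ι ℝ) : Matrix ι ι ℝ).det := by
      rw [Units.val_mul, det_mul, Matrix.coe_units_inv, det_nonsing_inv, Ring.inverse_eq_inv']
      rwa [← mul_pos_iff_of_pos_left (sq_pos_of_ne_zero A.det_ne_zero), ← mul_assoc, sq,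
        mul_self_mul_inv]
    have hj := (Joined.refl A).mul (joined_one_of_det_pos _ hdet)
    rw [mul_one, mul_inv_cancel_left] at hj
    exact connectedComponent_eq (pathComponent_subset_component A hj)

/-- For `n ≥ 1`, two invertible matrices `A, B ∈ GL(n, ℝ)` lie in the same connected
component iff their determinants have the same sign; consequently `GL(n, ℝ)` has exactly
two connected components. -/
theorem stmt11 (n : ℕ) (hn : 1 ≤ n) :
    (∀ A B : Matrix.GeneralLinearGroup (Fin n) ℝ,
      connectedComponent A = connectedComponent B ↔
        0 < (A : Matrix (Fin n) (Fin n) ℝ).det * (B : Matrix (Fin n) (Fin n) ℝ).det) ∧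
    Nat.card (ConnectedComponents (Matrix.GeneralLinearGroup (Fin n) ℝ)) = 2 := by
  have : Nonempty (Fin n) := ⟨⟨0, hn⟩⟩
  refine ⟨Matrix.GeneralLinearGroup.connectedComponent_eq_iff, Nat.card_eq_two_iff.2 ?_⟩
  have hdet := Matrix.det_diagonal_update_one (⟨0, hn⟩ : Fin n) (-1 : ℝ)
  let N : Matrix.GeneralLinearGroup (Fin n) ℝ :=
    Matrix.GeneralLinearGroup.mkOfDetNeZero _ (hdet.trans_ne (by norm_num))
  have hN : (N : Matrix (Fin n) (Fin n) ℝ).det = -1 := hdet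
  refine ⟨((1 : Matrix.GeneralLinearGroup (Fin n) ℝ) : ConnectedComponents _),
    (N : ConnectedComponents _), ?_, ?_⟩
  · rw [Ne, ConnectedComponents.coe_eq_coe,
      Matrix.GeneralLinearGroup.connectedComponent_eq_iff, hN]
    norm_num
  · refine Set.eq_univ_of_forall fun x ↦ ?_
    obtain ⟨A, rfl⟩ := ConnectedComponents.surjective_coe x
    simp only [Set.mem_insert_iff, Set.mem_singleton_iff, ConnectedComponents.coe_eq_coe,
      Matrix.GeneralLinearGroup.connectedComponent_eq_iff, hN]
    rcases A.det_ne_zero.lt_or_gt with h | h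
    · right; linarith
    · left; simpa using h
end
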